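/- Let A be an order-k real tensor with all mode dimensions equal to d (d ≥ 1), and let 1 ≤ ℓ ≤ k. Then d^{−(k−⌈k/ℓ⌉)/2} · ‖A‖_F ≤ min_{π ∈ P^ℓ_{[k]}} ‖Unfold_π(A)‖_σ, where P^ℓ_{[k]} denotes the set of partitions of [k] with exactly ℓ blocks and ⌈·⌉ is the ceiling function. -/

import Mathlib

open scoped BigOperators ENNReal

namespace TensorUnfolding

/-- The vector `l^p` norm of a finitely-indexed real vector, for `p ∈ [1, ∞]`
(for `p = ∞` it is the maximum of the absolute values of the entries). -/
noncomputable def pNorm (p : ℝ≥0∞) {ι : Type} [Fintype ι] (x : ι → ℝ) : ℝ :=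
  if p = ⊤ then ⨆ i, |x i| else (∑ i, |x i| ^ p.toReal) ^ (1 / p.toReal)

/-- `π` is a partition of `[k] = {0, …, k-1}`: a collection of disjoint nonempty
blocks whose union is all of `Fin k`. -/
def IsPartition {k : ℕ} (π : Finset (Finset (Fin k))) : Prop :=
  (∀ B ∈ π, B.Nonempty) ∧
  (∀ B ∈ π, ∀ B' ∈ π, B ≠ B' → Disjoint B B') ∧
  π.sup id = Finset.univ

/-- `π₁ ≤ π₂`: every block of `π₁` is contained in some block of `π₂`. -/
def Refines {k : ℕ} (π₁ π₂ : Finset (Finset (Fin k))) : Prop :=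
  ∀ B ∈ π₁, ∃ B' ∈ π₂, B ⊆ B'

/-- The finest partition `0_{[k]} = {{1}, …, {k}}`. -/
def botPartition (k : ℕ) : Finset (Finset (Fin k)) :=
  Finset.univ.image fun n => {n}

/-- The coarsest (one-block) partition `1_{[k]} = {[k]}`. -/
def topPartition (k : ℕ) : Finset (Finset (Fin k)) :=
  {Finset.univ}

/-- The meet `π₁ ∧ π₂`: the partition whose blocks are the nonempty
intersections `B ∩ B'` with `B ∈ π₁`, `B' ∈ π₂`. -/
def meetPartition {k : ℕ} (π₁ π₂ : Finset (Finset (Fin k))) : Finset (Finset (Fin k)) :=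
  ((π₁ ×ˢ π₂).image fun p => p.1 ∩ p.2).filter fun B => B.Nonempty

/-- The `l^p` operator norm of the unfolding of the tensor `A` induced by the
partition `π`: the supremum of `⟨A, ⊗_{B ∈ π} y_B⟩` over choices, for each block
`B ∈ π`, of a vector `y_B` indexed by `Π_{j ∈ B} Fin (d j)` with `l^p` norm 1. -/
noncomputable def unfoldNormP {k : ℕ} (p : ℝ≥0∞) (d : Fin k → ℕ)
    (A : ((n : Fin k) → Fin (d n)) → ℝ) (π : Finset (Finset (Fin k))) : ℝ :=
  sSup { r : ℝ |
    ∃ y : (B : Finset (Fin k)) → ((j : B) → Fin (d j.1)) → ℝ,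
      (∀ B ∈ π, pNorm p (y B) = 1) ∧
      r = ∑ i : (n : Fin k) → Fin (d n), A i * ∏ B ∈ π, y B fun j => i j.1 }

/-- The spectral norm of the unfolding of the tensor `A` induced by the
partition `π`: the supremum of `⟨A, ⊗_{B ∈ π} y_B⟩` over choices, for each block
`B ∈ π`, of a vector `y_B` indexed by `Π_{j ∈ B} Fin (d j)` with Euclidean norm 1. -/
noncomputable def unfoldNorm {k : ℕ} (d : Fin k → ℕ)
    (A : ((n : Fin k) → Fin (d n)) → ℝ) (π : Finset (Finset (Fin k))) : ℝ :=
  sSup { r : ℝ |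
    ∃ y : (B : Finset (Fin k)) → ((j : B) → Fin (d j.1)) → ℝ,
      (∀ B ∈ π, ∑ v, (y B v) ^ 2 = 1) ∧
      r = ∑ i : (n : Fin k) → Fin (d n), A i * ∏ B ∈ π, y B fun j => i j.1 }

/-- The `l^p` operator norm of the tensor `A`:
`‖A‖_p = sup { A(x₁, …, x_k) : ‖x_n‖_p = 1 }`. -/
noncomputable def opNormP {k : ℕ} (p : ℝ≥0∞) (d : Fin k → ℕ)
    (A : ((n : Fin k) → Fin (d n)) → ℝ) : ℝ :=
  sSup { r : ℝ | ∃ x : (n : Fin k) → Fin (d n) → ℝ,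
    (∀ n, pNorm p (x n) = 1) ∧
    r = ∑ i : (n : Fin k) → Fin (d n), A i * ∏ n, x n (i n) }

/-- The spectral norm of the tensor `A`:
`‖A‖_σ = sup { A(x₁, …, x_k) : ‖x_n‖₂ = 1 }`. -/
noncomputable def specNorm {k : ℕ} (d : Fin k → ℕ)
    (A : ((n : Fin k) → Fin (d n)) → ℝ) : ℝ :=
  sSup { r : ℝ | ∃ x : (n : Fin k) → Fin (d n) → ℝ,
    (∀ n, ∑ i, (x n i) ^ 2 = 1) ∧
    r = ∑ i : (n : Fin k) → Fin (d n), A i * ∏ n, x n (i n) }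

/-- The Frobenius norm of the tensor `A`. -/
noncomputable def frobNorm {k : ℕ} (d : Fin k → ℕ)
    (A : ((n : Fin k) → Fin (d n)) → ℝ) : ℝ :=
  Real.sqrt (∑ i : (n : Fin k) → Fin (d n), (A i) ^ 2)

/-- `D_A(B, B') = Π_{n ∈ B ∩ B'} d_n` if `B ∩ B' ≠ ∅`, and `0` otherwise. -/
def blockDim {k : ℕ} (d : Fin k → ℕ) (B B' : Finset (Fin k)) : ℕ :=
  if (B ∩ B').Nonempty then ∏ n ∈ B ∩ B', d n else 0

/-- `dim_A(π₁, π₂) = Π_{B ∈ π₁} max_{B' ∈ π₂} D_A(B, B')`. -/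
def dimRel {k : ℕ} (d : Fin k → ℕ) (π₁ π₂ : Finset (Finset (Fin k))) : ℕ :=
  ∏ B ∈ π₁, π₂.sup fun B' => blockDim d B B'

/-- `A` is `π`-orthogonal decomposable: `A = Σ_{n=1}^r λ_n a₁⁽ⁿ⁾ ⊗ ⋯ ⊗ a_k⁽ⁿ⁾`
with `λ₁ ≥ ⋯ ≥ λ_r ≥ 0` and `Π_{i ∈ B} ⟨a_i⁽ⁿ⁾, a_i⁽ᵐ⁾⟩ = δ_{nm}` for every
block `B ∈ π`. -/
def IsPiOD {k : ℕ} (d : Fin k → ℕ) (A : ((n : Fin k) → Fin (d n)) → ℝ)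
    (π : Finset (Finset (Fin k))) : Prop :=
  ∃ (r : ℕ) (lam : Fin r → ℝ) (a : Fin r → (n : Fin k) → Fin (d n) → ℝ),
    Antitone lam ∧ (∀ n, 0 ≤ lam n) ∧
    (∀ i, A i = ∑ n, lam n * ∏ m, a n m (i m)) ∧
    (∀ B ∈ π, ∀ n m : Fin r,
      (∏ j ∈ B, ∑ t, a n j t * a m j t) = if n = m then 1 else 0)

/-- Cauchy–Schwarz is attained by a unit vector. -/
lemma exists_unit_sum_mul_eq_sqrt {ι : Type*} [Fintype ι] [Nonempty ι] (x : ι → ℝ) :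
    ∃ y : ι → ℝ, ∑ v, y v ^ 2 = 1 ∧ ∑ v, x v * y v = Real.sqrt (∑ v, x v ^ 2) := by
  classical
  have hnn : 0 ≤ ∑ v, x v ^ 2 := Finset.sum_nonneg fun v _ => sq_nonneg _
  rcases hnn.eq_or_lt with h0 | hpos
  · have hx : ∀ v, x v = 0 := fun v => by
      simpa using (Finset.sum_eq_zero_iff_of_nonneg fun v _ => sq_nonneg (x v)).1 h0.symm v
        (Finset.mem_univ v)
    obtain ⟨v₀⟩ := ‹Nonempty ι›
    exact ⟨fun v => if v = v₀ then 1 else 0, by simp, by simp [hx]⟩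
  · have hs := Real.sq_sqrt hnn
    have hspos := Real.sqrt_pos.2 hpos
    refine ⟨fun v => x v / Real.sqrt (∑ v, x v ^ 2), ?_, ?_⟩
    · simp_rw [div_pow, ← Finset.sum_div, hs]
      exact div_self hpos.ne'
    · simp_rw [mul_div, ← sq, ← Finset.sum_div]
      rw [div_eq_iff hspos.ne', ← sq, hs]

lemma IsPartition.exists_mem {k : ℕ} {π : Finset (Finset (Fin k))} (hπ : IsPartition π)
    (n : Fin k) : ∃ B ∈ π, n ∈ B := by
  have h : n ∈ π.sup id := hπ.2.2 ▸ Finset.mem_univ n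
  simpa using h

/-- Some block of a partition of `[k]` into `ℓ` blocks has at least `⌈k/ℓ⌉` elements. -/
lemma IsPartition.exists_ceilDiv_le_card {k : ℕ} (hk : 1 ≤ k) {π : Finset (Finset (Fin k))}
    (hπ : IsPartition π) : ∃ B ∈ π, k ⌈/⌉ π.card ≤ B.card := by
  obtain ⟨B', hB', -⟩ := hπ.exists_mem ⟨0, hk⟩
  obtain ⟨B, hB, hmax⟩ := Finset.exists_max_image π Finset.card ⟨B', hB'⟩
  refine ⟨B, hB, (ceilDiv_le_iff_le_mul (Finset.card_pos.2 ⟨B, hB⟩)).2 ?_⟩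
  calc k = (π.sup id).card := by simp [hπ.2.2]
    _ ≤ ∑ C ∈ π, C.card := by
        rw [Finset.sup_eq_biUnion]; exact Finset.card_biUnion_le
    _ ≤ π.card * B.card := by
        simpa using Finset.sum_le_card_nsmul π Finset.card B.card hmax

lemma bddAbove_unfoldNorm {k : ℕ} (d : Fin k → ℕ)
    (A : ((n : Fin k) → Fin (d n)) → ℝ) (π : Finset (Finset (Fin k))) :
    BddAbove { r : ℝ |
      ∃ y : (B : Finset (Fin k)) → ((j : B) → Fin (d j.1)) → ℝ,
        (∀ B ∈ π, ∑ v, (y B v) ^ 2 = 1) ∧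
        r = ∑ i : (n : Fin k) → Fin (d n), A i * ∏ B ∈ π, y B fun j => i j.1 } := by
  refine ⟨∑ i, |A i|, ?_⟩
  rintro _ ⟨y, hy, rfl⟩
  refine Finset.sum_le_sum fun i _ => (le_abs_self _).trans ?_
  rw [abs_mul, Finset.abs_prod]
  refine mul_le_of_le_one_right (abs_nonneg _)
    (Finset.prod_le_one (fun _ _ => abs_nonneg _) fun B hB => ?_)
  rw [← sq_le_one_iff_abs_le_one, ← hy B hB]
  exact Finset.single_le_sum (f := fun v => y B v ^ 2) (fun v _ => sq_nonneg _)
    (Finset.mem_univ _)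

/-- The Frobenius norm of the slice of `A` along a block `B` of `π`, obtained by fixing the
indices `w` outside `B`, is at most the spectral norm of the unfolding induced by `π`. -/
lemma sqrt_slice_le_unfoldNorm {k : ℕ} {d : ℕ} (hd : 1 ≤ d) (A : (Fin k → Fin d) → ℝ)
    {π : Finset (Finset (Fin k))} (hπ : IsPartition π) {B : Finset (Fin k)} (hB : B ∈ π)
    (w : {n // n ∉ B} → Fin d) :
    Real.sqrt (∑ v : {n // n ∈ B} → Fin d,
        A ((Equiv.piEquivPiSubtypeProd (· ∈ B) fun _ => Fin d).symm (v, w)) ^ 2) ≤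
      unfoldNorm (fun _ => d) A π := by
  classical
  have : Nonempty (Fin d) := ⟨⟨0, hd⟩⟩
  set e := Equiv.piEquivPiSubtypeProd (· ∈ B) fun _ => Fin d with he
  obtain ⟨y₀, hy₀, hval⟩ := exists_unit_sum_mul_eq_sqrt
    fun v : {n // n ∈ B} → Fin d => A (e.symm (v, w))
  let j : Fin k → Fin d := e.symm (fun _ => ⟨0, hd⟩, w)
  let y : (C : Finset (Fin k)) → ((n : C) → Fin d) → ℝ := fun C =>
    if h : C = B then fun v => y₀ fun n => v ⟨n.1, h ▸ n.2⟩
    else fun v => if v = fun n => j n.1 then 1 else 0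
  have hyB : y B = y₀ := by simp [y]
  have hyC : ∀ C, C ≠ B → y C = fun v => if v = fun n : C => j n.1 then 1 else 0 :=
    fun C hC => by simp [y, hC]
  refine le_csSup (bddAbove_unfoldNorm _ A π) ⟨y, fun C _ => ?_, ?_⟩
  · by_cases hC : C = B
    · subst hC; rw [hyB]; exact hy₀
    · simp [hyC C hC]
  · have hprod : ∀ v w', ∏ C ∈ π, y C (fun n => e.symm (v, w') n.1) =
        y₀ v * if w' = w then 1 else 0 := by
      intro v w'
      rw [← Finset.mul_prod_erase π _ hB, hyB]
      congr 1
      · congr 1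
        funext n
        simp [he, Equiv.piEquivPiSubtypeProd]
      · rw [Finset.prod_congr rfl fun C hC => by rw [hyC C (Finset.ne_of_mem_erase hC)],
          Finset.prod_ite_zero]
        simp only [Finset.prod_const_one]
        refine if_congr ⟨fun h => ?_, ?_⟩ rfl rfl
        · funext n
          obtain ⟨C, hC, hn⟩ := hπ.exists_mem n.1
          have hCB : C ≠ B := fun h' => n.2 (h' ▸ hn)
          have := congrFun (h C (Finset.mem_erase.2 ⟨hCB, hC⟩)) ⟨n.1, hn⟩
          simpa [j, he, Equiv.piEquivPiSubtypeProd, n.2] using this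
        · rintro rfl C hC
          funext n
          have hn : n.1 ∉ B := Finset.disjoint_left.1
            (hπ.2.1 C (Finset.mem_of_mem_erase hC) B hB (Finset.ne_of_mem_erase hC)) n.2
          simp [j, he, Equiv.piEquivPiSubtypeProd, hn]
    rw [← hval, ← Equiv.sum_comp e.symm, Fintype.sum_prod_type]
    refine Finset.sum_congr rfl fun v _ => ?_
    simp [hprod]

/-- Fixing the indices outside a block `B` suitably keeps at least the average share of the
squared Frobenius norm. -/
lemma exists_slice_ge {k : ℕ} {d : ℕ} (hd : 1 ≤ d) (A : (Fin k → Fin d) → ℝ)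
    (B : Finset (Fin k)) :
    ∃ w : {n // n ∉ B} → Fin d,
      ∑ i, A i ^ 2 ≤ (d : ℝ) ^ (k - B.card) * ∑ v : {n // n ∈ B} → Fin d,
        A ((Equiv.piEquivPiSubtypeProd (· ∈ B) fun _ => Fin d).symm (v, w)) ^ 2 := by
  classical
  have : Nonempty (Fin d) := ⟨⟨0, hd⟩⟩
  set e := Equiv.piEquivPiSubtypeProd (· ∈ B) fun _ => Fin d
  obtain ⟨w, -, hw⟩ := Finset.exists_max_image (Finset.univ : Finset ({n // n ∉ B} → Fin d))
    (fun w => ∑ v : {n // n ∈ B} → Fin d, A (e.symm (v, w)) ^ 2) Finset.univ_nonempty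
  refine ⟨w, ?_⟩
  rw [← Equiv.sum_comp e.symm, Fintype.sum_prod_type, Finset.sum_comm]
  refine (Finset.sum_le_card_nsmul _ _ _ hw).trans_eq ?_
  simp [Fintype.card_subtype_compl]

end TensorUnfolding

open TensorUnfolding in
/-- For an order-`k` tensor with all mode dimensions equal to `d`
and `1 ≤ ℓ ≤ k`,
`d^{−(k−⌈k/ℓ⌉)/2} ‖A‖_F ≤ min_{π ∈ P^ℓ_{[k]}} ‖Unfold_π(A)‖_σ`. -/
theorem ceil_lower_bound {k : ℕ} (d : ℕ) (hd : 1 ≤ d) (ℓ : ℕ)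
    (hℓ : 1 ≤ ℓ) (hℓk : ℓ ≤ k)
    (A : (Fin k → Fin d) → ℝ) :
    ∀ π : Finset (Finset (Fin k)), IsPartition π → π.card = ℓ →
      (d : ℝ) ^ (-(((k - k ⌈/⌉ ℓ : ℕ) : ℝ)) / 2) * frobNorm (fun _ => d) A ≤
        unfoldNorm (fun _ => d) A π := by
  rintro π hπ rfl
  obtain ⟨B, hB, hcard⟩ := hπ.exists_ceilDiv_le_card (hℓ.trans hℓk)
  obtain ⟨w, hw⟩ := exists_slice_ge hd A B
  refine le_trans ?_ (sqrt_slice_le_unfoldNorm hd A hπ hB w)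
  have hd0 : (0 : ℝ) < d := by exact_mod_cast hd
  have hd1 : (1 : ℝ) ≤ d := by exact_mod_cast hd
  generalize k ⌈/⌉ π.card = c at hcard ⊢
  rw [neg_div, Real.rpow_neg hd0.le, inv_mul_le_iff₀ (Real.rpow_pos_of_pos hd0 _),
    Real.rpow_div_two_eq_sqrt _ hd0.le, Real.rpow_natCast, frobNorm]
  refine Real.sqrt_le_iff.2 ⟨by positivity, hw.trans ?_⟩
  rw [mul_pow, pow_right_comm, Real.sq_sqrt hd0.le,
    Real.sq_sqrt (Finset.sum_nonneg fun v _ => sq_nonneg _)]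
  gcongr
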